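/- If G is an arborescence on n vertices with clique number k, then ℓ(G) = 2n − k, i.e., the minimum length of a word representing G equals 2n − k. -/

import Mathlib

/-- A strict partial order (irreflexive and transitive relation). -/
def IsStrictPO {V : Type*} (lt : V → V → Prop) : Prop :=
  (∀ a, ¬ lt a a) ∧ ∀ a b c, lt a b → lt b c → lt a c

/-- `b` covers `a` in the strict order `lt`. -/
def CovRel {V : Type*} (lt : V → V → Prop) (a b : V) : Prop :=
  lt a b ∧ ∀ c, lt a c → ¬ lt c b

/-- The Hasse diagram of a strict order: vertices joined iff one covers the other. -/
def hasseGraph {V : Type*} (lt : V → V → Prop) : SimpleGraph V :=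
  SimpleGraph.fromRel (CovRel lt)

/-- `lt` is a treelike orientation of `G`: a transitive orientation
(a strict partial order in which distinct vertices are adjacent iff comparable)
whose Hasse diagram is a tree. -/
def IsTreelikeOrientation {V : Type*} (G : SimpleGraph V) (lt : V → V → Prop) : Prop :=
  IsStrictPO lt ∧ (∀ a b : V, G.Adj a b ↔ (lt a b ∨ lt b a)) ∧ (hasseGraph lt).IsTree

/-- A treelike comparability graph: a graph admitting a treelike orientation. -/
def IsTreelikeComparability {V : Type*} (G : SimpleGraph V) : Prop :=
  ∃ lt : V → V → Prop, IsTreelikeOrientation G lt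

/-- A double-arborescence: a treelike comparability graph with an all-adjacent vertex. -/
def IsDoubleArborescence {V : Type*} (G : SimpleGraph V) : Prop :=
  IsTreelikeComparability G ∧ ∃ r : V, ∀ v : V, v ≠ r → G.Adj r v

/-- An arborescence: a treelike comparability graph admitting a treelike orientation
in which some vertex is the greatest or the least element. -/
def IsArborescence {V : Type*} (G : SimpleGraph V) : Prop :=
  ∃ lt : V → V → Prop, IsTreelikeOrientation G lt ∧
    ∃ r : V, (∀ v : V, v ≠ r → lt v r) ∨ (∀ v : V, v ≠ r → lt r v)

/-- `G` contains an induced path on four vertices. -/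
def HasInducedP4 {V : Type*} (G : SimpleGraph V) : Prop :=
  ∃ a b c d : V, a ≠ b ∧ a ≠ c ∧ a ≠ d ∧ b ≠ c ∧ b ≠ d ∧ c ≠ d ∧
    G.Adj a b ∧ G.Adj b c ∧ G.Adj c d ∧ ¬ G.Adj a c ∧ ¬ G.Adj a d ∧ ¬ G.Adj b d

/-- `G` is `P4`-free. -/
def P4Free {V : Type*} (G : SimpleGraph V) : Prop := ¬ HasInducedP4 G

/-- `G` contains an induced cycle on four vertices. -/
def HasInducedC4 {V : Type*} (G : SimpleGraph V) : Prop :=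
  ∃ a b c d : V, a ≠ b ∧ a ≠ c ∧ a ≠ d ∧ b ≠ c ∧ b ≠ d ∧ c ≠ d ∧
    G.Adj a b ∧ G.Adj b c ∧ G.Adj c d ∧ G.Adj d a ∧ ¬ G.Adj a c ∧ ¬ G.Adj b d

/-- `G` is `C4`-free. -/
def C4Free {V : Type*} (G : SimpleGraph V) : Prop := ¬ HasInducedC4 G

/-- Two distinct letters `a` and `b` alternate in the word `w`: the subsequence of `w`
consisting of all occurrences of `a` and `b` has no two consecutive equal letters. -/
def Alternates {V : Type*} [DecidableEq V] (w : List V) (a b : V) : Prop :=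
  (w.filter (fun x => decide (x = a ∨ x = b))).Chain' (· ≠ ·)

/-- The word `w` represents the graph `G`: every vertex occurs in `w`, and distinct
vertices are adjacent iff they alternate in `w`. -/
def Represents {V : Type*} [DecidableEq V] (G : SimpleGraph V) (w : List V) : Prop :=
  (∀ v : V, v ∈ w) ∧ ∀ a b : V, a ≠ b → (G.Adj a b ↔ Alternates w a b)

/-- The word `w`, whose letters all lie in `S`, represents the induced subgraph `G[S]`. -/
def RepresentsOn {V : Type*} [DecidableEq V] (G : SimpleGraph V) (S : Set V)
    (w : List V) : Prop :=
  (∀ x ∈ w, x ∈ S) ∧ (∀ v ∈ S, v ∈ w) ∧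
    ∀ a ∈ S, ∀ b ∈ S, a ≠ b → (G.Adj a b ↔ Alternates w a b)

section Order

variable {V : Type*} {lt : V → V → Prop}

lemma hasseGraph_swap (lt : V → V → Prop) :
    hasseGraph (fun a b => lt b a) = hasseGraph lt := by
  ext a b
  simp only [hasseGraph, SimpleGraph.fromRel_adj, CovRel]
  grind

lemma IsStrictPO.swap (h : IsStrictPO lt) : IsStrictPO (fun a b => lt b a) :=
  ⟨h.1, fun _ _ _ hab hbc => h.2 _ _ _ hbc hab⟩

lemma IsTreelikeOrientation.swap {G : SimpleGraph V} (h : IsTreelikeOrientation G lt) :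
    IsTreelikeOrientation G (fun a b => lt b a) := by
  refine ⟨h.1.swap, fun a b => ?_, ?_⟩
  · rw [h.2.1 a b, or_comm]
  · rw [hasseGraph_swap]
    exact h.2.2

lemma IsStrictPO.wellFounded [Finite V] (h : IsStrictPO lt) : WellFounded lt := by
  have : Std.Irrefl lt := ⟨h.1⟩
  have : IsTrans V lt := ⟨h.2⟩
  exact Finite.wellFounded_of_trans_of_irrefl lt

lemma pairwise_support_append {H : SimpleGraph V} (h : IsStrictPO lt) {a b c : V}
    {p : H.Walk a b} {q : H.Walk b c} (hp : p.support.Pairwise lt)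
    (hq : q.support.Pairwise lt) : (p.append q).support.Pairwise lt := by
  have hpb : ∀ x ∈ p.support, x = b ∨ lt x b := by
    rw [← p.dropLast_support_concat, List.pairwise_append] at hp
    intro x hx
    rw [← p.dropLast_support_concat, List.mem_append] at hx
    rcases hx with hx | hx
    · exact Or.inr (hp.2.2 x hx b (by simp))
    · exact Or.inl (by simpa using hx)
  rw [← q.cons_tail_support, List.pairwise_cons] at hq
  rw [SimpleGraph.Walk.support_append, List.pairwise_append]
  refine ⟨hp, hq.2, fun x hx y hy => ?_⟩
  rcases hpb x hx with rfl | hx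
  exacts [hq.1 y hy, h.2 _ _ _ hx (hq.1 y hy)]

/-- Comparable elements are joined in the Hasse diagram by an increasing walk. -/
lemma IsStrictPO.exists_increasing_walk [Finite V] (h : IsStrictPO lt) {a b : V} (hab : lt a b) :
    ∃ p : (hasseGraph lt).Walk a b, p.support.Pairwise lt := by
  induction b using h.wellFounded.induction generalizing a with
  | _ b ihb =>
  obtain ⟨m, ⟨ham, hmb⟩, hmin⟩ :=
    h.swap.wellFounded.has_min {m | (m = a ∨ lt a m) ∧ lt m b} ⟨a, Or.inl rfl, hab⟩
  have hmax : ∀ c, lt m c → ¬ lt c b := by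
    refine fun c hmc hcb => hmin c ⟨Or.inr ?_, hcb⟩ hmc
    rcases ham with rfl | ham
    exacts [hmc, h.2 _ _ _ ham hmc]
  have hadj : (hasseGraph lt).Adj m b := by
    rw [hasseGraph, SimpleGraph.fromRel_adj]
    refine ⟨?_, Or.inl ⟨hmb, hmax⟩⟩
    rintro rfl
    exact h.1 _ hmb
  obtain ⟨p, hp⟩ : ∃ p : (hasseGraph lt).Walk a m, p.support.Pairwise lt := by
    rcases ham with rfl | ham
    · exact ⟨SimpleGraph.Walk.nil, by simp⟩
    · exact ihb m hmb ham
  exact ⟨p.append hadj.toWalk, pairwise_support_append h hp (by simpa using hmb)⟩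

/-- If the Hasse diagram is acyclic and there is a least element, then the elements below any
given element form a chain. -/
lemma IsStrictPO.comparable_of_lt [Finite V] (h : IsStrictPO lt)
    (hac : (hasseGraph lt).IsAcyclic) {r : V} (hr : ∀ v, v ≠ r → lt r v) {a b c : V}
    (hca : lt a c) (hbc : lt b c) : a = b ∨ lt a b ∨ lt b a := by
  have key : ∀ x, lt x c → ∃ p : (hasseGraph lt).Walk r c, p.support.Pairwise lt ∧
      x ∈ p.support := by
    intro x hxc
    obtain ⟨q, hq⟩ := h.exists_increasing_walk hxc
    by_cases hx : x = r
    · subst hx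
      exact ⟨q, hq, q.start_mem_support⟩
    · obtain ⟨p, hp⟩ := h.exists_increasing_walk (hr x hx)
      exact ⟨p.append q, pairwise_support_append h hp hq, by simp⟩
  have hnodup : ∀ l : List V, l.Pairwise lt → l.Nodup := fun l hl =>
    hl.imp fun {x y} hxy => by rintro rfl; exact h.1 _ hxy
  obtain ⟨p, hp, hap⟩ := key a hca
  obtain ⟨q, hq, hbq⟩ := key b hbc
  have hpq : p = q := congrArg Subtype.val ((hac.subsingleton_path r c).elim
    ⟨p, (SimpleGraph.Walk.isPath_def p).2 (hnodup _ hp)⟩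
    ⟨q, (SimpleGraph.Walk.isPath_def q).2 (hnodup _ hq)⟩)
  subst hpq
  by_contra! hne
  have hcomp : p.support.Pairwise fun x y => lt x y ∨ lt y x := hp.imp Or.inl
  have : Std.Symm fun x y => lt x y ∨ lt y x := ⟨fun _ _ => Or.symm⟩
  exact (hcomp.forall hap hbq hne.1).elim hne.2.1 hne.2.2

end Order

section Realizer

variable {V : Type*} [DecidableEq V]

/-- The restriction of a word to two letters. -/
def restrictPair (a b : V) (l : List V) : List V :=
  l.filter fun x => decide (x = a ∨ x = b)

lemma restrictPair_append (a b : V) (l m : List V) :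
    restrictPair a b (l ++ m) = restrictPair a b l ++ restrictPair a b m :=
  List.filter_append ..

lemma restrictPair_comm (a b : V) (l : List V) : restrictPair a b l = restrictPair b a l := by
  simp only [restrictPair, or_comm]

lemma restrictPair_eq_nil {a b : V} {l : List V} (ha : a ∉ l) (hb : b ∉ l) :
    restrictPair a b l = [] := by
  simp only [restrictPair, List.filter_eq_nil_iff, decide_eq_true_eq]
  rintro x hx (rfl | rfl) <;> contradiction

lemma restrictPair_of_notMem_right {a b : V} {l : List V} (hl : l.Nodup) (ha : a ∈ l)
    (hb : b ∉ l) : restrictPair a b l = [a] := by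
  rw [restrictPair, ← List.replicate_one, ← List.count_eq_one_of_mem hl ha, ← List.filter_eq]
  refine List.filter_congr fun x hx => ?_
  have : x ≠ b := by rintro rfl; exact hb hx
  simp [this, eq_comm]

lemma restrictPair_of_notMem_left {a b : V} {l : List V} (hl : l.Nodup) (ha : a ∉ l)
    (hb : b ∈ l) : restrictPair a b l = [b] := by
  rw [restrictPair_comm, restrictPair_of_notMem_right hl hb ha]

/-- The enumerations `L₁`, `L₂` of `S` are linear extensions of `lt` that order every incomparable
pair oppositely, and `L₁` puts the elements of `C` first in such a pair. -/
structure IsRealizer (lt : V → V → Prop) (C S : Finset V) (L₁ L₂ : List V) : Prop where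
  nodup₁ : L₁.Nodup
  nodup₂ : L₂.Nodup
  mem₁ : ∀ x, x ∈ L₁ ↔ x ∈ S
  mem₂ : ∀ x, x ∈ L₂ ↔ x ∈ S
  of_lt : ∀ a ∈ S, ∀ b ∈ S, lt a b → restrictPair a b L₁ = [a, b] ∧ restrictPair a b L₂ = [a, b]
  of_incomp : ∀ a ∈ S, ∀ b ∈ S, a ≠ b → ¬ lt a b → ¬ lt b a → b ∉ C →
    (restrictPair a b L₁ = [a, b] ∧ restrictPair a b L₂ = [b, a]) ∨
      (a ∉ C ∧ restrictPair a b L₁ = [b, a] ∧ restrictPair a b L₂ = [a, b])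

variable {lt : V → V → Prop} {C : Finset V}

lemma IsRealizer.cons {S : Finset V} {L₁ L₂ : List V} {r : V} (h : IsRealizer lt C S L₁ L₂)
    (hpo : IsStrictPO lt) (hr : ∀ x ∈ S, lt r x) :
    IsRealizer lt C (insert r S) (r :: L₁) (r :: L₂) := by
  have hrS : r ∉ S := fun hrS => hpo.1 _ (hr r hrS)
  have hr₁ : r ∉ L₁ := by rwa [h.mem₁]
  have hr₂ : r ∉ L₂ := by rwa [h.mem₂]
  have hcons : ∀ L : List V, L.Nodup → r ∉ L → ∀ x ∈ L, restrictPair r x (r :: L) = [r, x] := by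
    intro L hL hrL x hx
    have := restrictPair_of_notMem_left hL hrL hx
    simpa [restrictPair] using this
  have hskip : ∀ a ∈ S, ∀ b ∈ S, ∀ L : List V,
      restrictPair a b (r :: L) = restrictPair a b L := by
    intro a ha b hb L
    have h1 : r ≠ a := by rintro rfl; contradiction
    have h2 : r ≠ b := by rintro rfl; contradiction
    simp [restrictPair, h1, h2]
  refine ⟨List.nodup_cons.2 ⟨hr₁, h.nodup₁⟩, List.nodup_cons.2 ⟨hr₂, h.nodup₂⟩,
    by simp [h.mem₁], by simp [h.mem₂], fun a ha b hb hab => ?_,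
    fun a ha b hb hne hab hba hbC => ?_⟩
  · rw [Finset.mem_insert] at ha hb
    rcases ha with rfl | ha <;> rcases hb with rfl | hb
    · exact (hpo.1 _ hab).elim
    · exact ⟨hcons _ h.nodup₁ hr₁ b ((h.mem₁ b).2 hb), hcons _ h.nodup₂ hr₂ b ((h.mem₂ b).2 hb)⟩
    · exact (hpo.1 _ (hpo.2 _ _ _ hab (hr a ha))).elim
    · rw [hskip a ha b hb, hskip a ha b hb]
      exact h.of_lt a ha b hb hab
  · rw [Finset.mem_insert] at ha hb
    rcases ha with rfl | ha <;> rcases hb with rfl | hb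
    · exact (hne rfl).elim
    · exact (hab (hr b hb)).elim
    · exact (hba (hr a ha)).elim
    · rw [hskip a ha b hb, hskip a ha b hb]
      exact h.of_incomp a ha b hb hne hab hba hbC

lemma IsRealizer.union {S T : Finset V} {L₁ L₂ M₁ M₂ : List V} (hS : IsRealizer lt C S L₁ L₂)
    (hT : IsRealizer lt C T M₁ M₂) (hdisj : Disjoint S T)
    (hST : ∀ a ∈ S, ∀ b ∈ T, ¬ lt a b ∧ ¬ lt b a) (hC : ∀ b ∈ T, b ∉ C) :
    IsRealizer lt C (S ∪ T) (L₁ ++ M₁) (M₂ ++ L₂) := by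
  have hT' : ∀ a ∈ S, a ∉ T := fun a ha => Finset.disjoint_left.1 hdisj ha
  have hS' : ∀ a ∈ T, a ∉ S := fun a ha => Finset.disjoint_right.1 hdisj ha
  have hSS : ∀ a ∈ S, ∀ b ∈ S, restrictPair a b (L₁ ++ M₁) = restrictPair a b L₁ ∧
      restrictPair a b (M₂ ++ L₂) = restrictPair a b L₂ := by
    intro a ha b hb
    rw [restrictPair_append, restrictPair_append,
      restrictPair_eq_nil (l := M₁) (by simpa [hT.mem₁] using hT' a ha)
        (by simpa [hT.mem₁] using hT' b hb),
      restrictPair_eq_nil (l := M₂) (by simpa [hT.mem₂] using hT' a ha)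
        (by simpa [hT.mem₂] using hT' b hb)]
    simp
  have hTT : ∀ a ∈ T, ∀ b ∈ T, restrictPair a b (L₁ ++ M₁) = restrictPair a b M₁ ∧
      restrictPair a b (M₂ ++ L₂) = restrictPair a b M₂ := by
    intro a ha b hb
    rw [restrictPair_append, restrictPair_append,
      restrictPair_eq_nil (l := L₁) (by simpa [hS.mem₁] using hS' a ha)
        (by simpa [hS.mem₁] using hS' b hb),
      restrictPair_eq_nil (l := L₂) (by simpa [hS.mem₂] using hS' a ha)
        (by simpa [hS.mem₂] using hS' b hb)]
    simp
  have hmix : ∀ a ∈ S, ∀ b ∈ T, restrictPair a b (L₁ ++ M₁) = [a, b] ∧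
      restrictPair a b (M₂ ++ L₂) = [b, a] := by
    intro a ha b hb
    rw [restrictPair_append, restrictPair_append,
      restrictPair_of_notMem_right hS.nodup₁ ((hS.mem₁ a).2 ha)
        (by simpa [hS.mem₁] using hS' b hb),
      restrictPair_of_notMem_left hT.nodup₁ (by simpa [hT.mem₁] using hT' a ha)
        ((hT.mem₁ b).2 hb),
      restrictPair_of_notMem_right hS.nodup₂ ((hS.mem₂ a).2 ha)
        (by simpa [hS.mem₂] using hS' b hb),
      restrictPair_of_notMem_left hT.nodup₂ (by simpa [hT.mem₂] using hT' a ha)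
        ((hT.mem₂ b).2 hb)]
    simp
  refine ⟨hS.nodup₁.append hT.nodup₁ fun x hx hx' => ?_,
    hT.nodup₂.append hS.nodup₂ fun x hx hx' => ?_,
    by simp [hS.mem₁, hT.mem₁], by simp [hS.mem₂, hT.mem₂, or_comm],
    fun a ha b hb hab => ?_, fun a ha b hb hne hab hba hbC => ?_⟩
  · exact hT' x ((hS.mem₁ x).1 hx) ((hT.mem₁ x).1 hx')
  · exact hT' x ((hS.mem₂ x).1 hx') ((hT.mem₂ x).1 hx)
  · rcases Finset.mem_union.1 ha with ha | ha <;> rcases Finset.mem_union.1 hb with hb | hb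
    · rw [(hSS a ha b hb).1, (hSS a ha b hb).2]
      exact hS.of_lt a ha b hb hab
    · exact ((hST a ha b hb).1 hab).elim
    · exact ((hST b hb a ha).2 hab).elim
    · rw [(hTT a ha b hb).1, (hTT a ha b hb).2]
      exact hT.of_lt a ha b hb hab
  · rcases Finset.mem_union.1 ha with ha | ha <;> rcases Finset.mem_union.1 hb with hb | hb
    · rw [(hSS a ha b hb).1, (hSS a ha b hb).2]
      exact hS.of_incomp a ha b hb hne hab hba hbC
    · exact Or.inl (hmix a ha b hb)
    · rw [restrictPair_comm a b, restrictPair_comm a b]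
      exact Or.inr ⟨hC a ha, hmix b hb a ha⟩
    · rw [(hTT a ha b hb).1, (hTT a ha b hb).2]
      exact hT.of_incomp a ha b hb hne hab hba hbC

lemma exists_isRealizer [Finite V] (hpo : IsStrictPO lt)
    (hforest : ∀ a b c, lt a c → lt b c → a = b ∨ lt a b ∨ lt b a)
    (hC : ∀ a ∈ C, ∀ b ∈ C, a ≠ b → lt a b ∨ lt b a) (S : Finset V) :
    ∃ L₁ L₂, IsRealizer lt C S L₁ L₂ := by
  classical
  induction S using Finset.strongInduction with
  | H S ih =>
  rcases S.eq_empty_or_nonempty with rfl | hne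
  · exact ⟨[], [], by constructor <;> simp⟩
  obtain ⟨r, hrS, hmin⟩ := hpo.wellFounded.has_min (S : Set V) hne
  have hrS : r ∈ S := hrS
  have hmin : ∀ x ∈ S, ¬ lt x r := hmin
  set U := S.filter (lt r) with hU
  set T := S.filter (fun x => x ≠ r ∧ ¬ lt r x) with hT
  have hUr : r ∉ U := by simp [hU, hpo.1]
  have hTr : r ∉ T := by simp [hT]
  obtain ⟨L₁, L₂, hL⟩ := ih U
    (Finset.ssubset_iff_subset_ne.2 ⟨Finset.filter_subset _ _, by rintro h; exact hUr (h ▸ hrS)⟩)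
  obtain ⟨M₁, M₂, hM⟩ := ih T
    (Finset.ssubset_iff_subset_ne.2 ⟨Finset.filter_subset _ _, by rintro h; exact hTr (h ▸ hrS)⟩)
  have hL' := hL.cons hpo (r := r) (fun x hx => (Finset.mem_filter.1 hx).2)
  have hdisj : Disjoint (insert r U) T := by
    rw [Finset.disjoint_left]
    simp only [hU, hT, Finset.mem_insert, Finset.mem_filter]
    grind
  have hunion : insert r U ∪ T = S := by
    ext x
    simp only [hU, hT, Finset.mem_union, Finset.mem_insert, Finset.mem_filter]
    grind
  have hinc : ∀ a ∈ insert r U, ∀ b ∈ T, ¬ lt a b ∧ ¬ lt b a := by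
    simp only [hU, hT, Finset.mem_insert, Finset.mem_filter]
    rintro a (rfl | ⟨haS, hra⟩) b ⟨hbS, hbr, hrb⟩
    · exact ⟨hrb, hmin b hbS⟩
    · refine ⟨fun hab => hrb (hpo.2 _ _ _ hra hab), fun hba => ?_⟩
      rcases hforest _ _ _ hra hba with h | h | h
      exacts [hbr h.symm, hrb h, hmin b hbS h]
  by_cases hCT : ∀ b ∈ T, b ∉ C
  · exact ⟨_, _, hunion ▸ hL'.union hM hdisj hinc hCT⟩
  · push Not at hCT
    obtain ⟨b, hbT, hbC⟩ := hCT
    refine ⟨_, _, hunion ▸ Finset.union_comm _ T ▸ hM.union hL' hdisj.symm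
      (fun x hx y hy => (hinc y hy x hx).symm) fun a ha haC => ?_⟩
    have hab : a ≠ b := by rintro rfl; exact Finset.disjoint_left.1 hdisj ha hbT
    exact (hC a haC b hbC hab).elim (hinc a ha b hbT).1 (hinc a ha b hbT).2

end Realizer

section Words

variable {V : Type*} [DecidableEq V]

lemma alternates_comm {w : List V} {a b : V} : Alternates w a b ↔ Alternates w b a := by
  simp only [Alternates, or_comm]

lemma alternates_filter_append {C : Finset V} {L₁ L₂ : List V} {a b : V} :
    Alternates (L₁.filter (· ∉ C) ++ L₂) a b ↔
      List.IsChain (· ≠ ·) ((restrictPair a b L₁).filter (· ∉ C) ++ restrictPair a b L₂) := by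
  rw [Alternates, restrictPair, restrictPair, List.filter_append, List.filter_comm]
  rfl

/-- Deleting from the first half of `L₁ ++ L₂` the letters of a maximal chain `C` yields a word
representing the comparability graph. -/
lemma IsRealizer.represents [Fintype V] {lt : V → V → Prop} {C : Finset V} {G : SimpleGraph V}
    {L₁ L₂ : List V} (h : IsRealizer lt C Finset.univ L₁ L₂) (hpo : IsStrictPO lt)
    (hG : ∀ a b, G.Adj a b ↔ (lt a b ∨ lt b a))
    (hchain : ∀ a ∈ C, ∀ b ∈ C, a ≠ b → lt a b ∨ lt b a)
    (hC : ∀ a b, lt a b → b ∈ C → a ∈ C) :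
    Represents G (L₁.filter (· ∉ C) ++ L₂) := by
  refine ⟨fun v => by simp [h.mem₂], fun a b hne => ?_⟩
  have hlt : ∀ a b, lt a b → Alternates (L₁.filter (· ∉ C) ++ L₂) a b := by
    intro a b hab
    have hne : a ≠ b := by rintro rfl; exact hpo.1 _ hab
    rw [alternates_filter_append, (h.of_lt a (by simp) b (by simp) hab).1,
      (h.of_lt a (by simp) b (by simp) hab).2]
    have := hC a b hab
    by_cases ha : a ∈ C <;> by_cases hb : b ∈ C <;> simp_all [hne.symm]
  have hinc : ∀ a b, a ≠ b → ¬ lt a b → ¬ lt b a → b ∉ C →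
      ¬ Alternates (L₁.filter (· ∉ C) ++ L₂) a b := by
    intro a b hne hab hba hb
    rw [alternates_filter_append]
    rcases h.of_incomp a (by simp) b (by simp) hne hab hba hb with ⟨h1, h2⟩ | ⟨ha, h1, h2⟩
    · rw [h1, h2]
      by_cases ha : a ∈ C <;> simp [ha, hb]
    · rw [h1, h2]
      simp [ha, hb]
  rw [hG]
  constructor
  · rintro (hab | hba)
    exacts [hlt a b hab, alternates_comm.1 (hlt b a hba)]
  · intro halt
    by_contra! hcon
    by_cases hb : b ∈ C
    · have ha : a ∉ C := fun ha => (hchain a ha b hb hne).elim hcon.1 hcon.2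
      exact hinc b a hne.symm hcon.2 hcon.1 ha (alternates_comm.1 halt)
    · exact hinc a b hne hcon.1 hcon.2 hb halt

lemma alternates_of_count_eq_one {w : List V} {a b : V} (ha : w.count a = 1)
    (hb : w.count b = 1) : Alternates w a b := by
  refine List.Pairwise.isChain (List.nodup_iff_count_le_one.2 fun x => ?_)
  by_cases hx : x = a ∨ x = b
  · rw [List.count_filter (by simpa using hx)]
    rcases hx with rfl | rfl <;> omega
  · rw [List.count_eq_zero_of_not_mem (by simp [hx])]
    exact zero_le_one

/-- The letters occurring once in a word representing `G` form a clique, whence a lower bound on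
the length of the word. -/
lemma Represents.two_mul_card_le [Fintype V] {G : SimpleGraph V} {w : List V}
    (h : Represents G w) :
    ∃ s : Finset V, G.IsClique s ∧ 2 * Fintype.card V ≤ w.length + s.card := by
  refine ⟨Finset.univ.filter fun v => w.count v = 1, ?_, ?_⟩
  · intro a ha b hb hne
    simp only [Finset.coe_filter, Finset.mem_univ, true_and, Set.mem_ofPred_eq] at ha hb
    exact (h.2 a b hne).2 (alternates_of_count_eq_one ha hb)
  · have hlen : ∑ v : V, w.count v = w.length := by
      simpa using Multiset.sum_count_eq_card (s := Finset.univ) (m := (w : Multiset V)) (by simp)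
    rw [← hlen, Finset.card_filter, ← Finset.sum_add_distrib, mul_comm, ← smul_eq_mul,
      ← Finset.card_univ, ← Finset.sum_const]
    refine Finset.sum_le_sum fun v _ => ?_
    have := List.count_pos_iff.2 (h.1 v)
    split_ifs <;> omega

end Words

/-- If `G` is an arborescence on `n` vertices with clique number `k`, then the
minimum length of a word representing `G` is `2n - k`. -/
theorem arborescence_min_word_length
    {V : Type*} [Fintype V] [DecidableEq V] (G : SimpleGraph V)
    (hconn : G.Connected) (hG : IsArborescence G)
    (n k : ℕ) (hn : Fintype.card V = n)
    (hk : IsGreatest {m : ℕ | ∃ s : Finset V, G.IsNClique m s} k) :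
    IsLeast {m : ℕ | ∃ w : List V, Represents G w ∧ w.length = m} (2 * n - k) := by
  subst hn
  constructor
  · obtain ⟨lt, hlt, r, hr⟩ : ∃ lt : V → V → Prop, IsTreelikeOrientation G lt ∧
        ∃ r : V, ∀ v : V, v ≠ r → lt r v := by
      obtain ⟨lt, hlt, r, hr | hr⟩ := hG
      exacts [⟨_, hlt.swap, r, hr⟩, ⟨_, hlt, r, hr⟩]
    obtain ⟨hpo, hadj, htree⟩ := hlt
    have hforest : ∀ a b c, lt a c → lt b c → a = b ∨ lt a b ∨ lt b a :=
      fun a b c => hpo.comparable_of_lt htree.isAcyclic hr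
    obtain ⟨⟨C, hC⟩, hmax⟩ := hk
    have hchain : ∀ a ∈ C, ∀ b ∈ C, a ≠ b → lt a b ∨ lt b a :=
      fun a ha b hb hne => (hadj a b).1 (hC.isClique ha hb hne)
    have hdown : ∀ a b, lt a b → b ∈ C → a ∈ C := by
      intro a b hab hb
      by_contra ha
      have hcl : G.IsNClique (k + 1) (insert a C) := by
        refine hC.insert fun c hc => (hadj a c).2 ?_
        by_cases hcb : c = b
        · exact Or.inl (hcb ▸ hab)
        · rcases hchain c hc b hb hcb with h | h
          · exact (hforest a c b hab h).resolve_left (by rintro rfl; exact ha hc)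
          · exact Or.inl (hpo.2 _ _ _ hab h)
      have := hmax ⟨_, hcl⟩
      omega
    obtain ⟨L₁, L₂, hL⟩ := exists_isRealizer hpo hforest hchain Finset.univ
    refine ⟨_, hL.represents hpo hadj hchain hdown, ?_⟩
    have h₂ : L₂.length = Fintype.card V := by
      rw [← List.toFinset_card_of_nodup hL.nodup₂, ← Finset.card_univ]
      congr 1
      ext x
      simp [hL.mem₂]
    have h₁ : (L₁.filter (· ∉ C)).length = Fintype.card V - k := by
      rw [← List.toFinset_card_of_nodup (hL.nodup₁.filter _), ← hC.card_eq, ← Finset.card_compl]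
      congr 1
      ext x
      simp [hL.mem₁]
    have hle : k ≤ Fintype.card V := hC.card_eq ▸ C.card_le_univ
    rw [List.length_append, h₁, h₂]
    omega
  · rintro m ⟨w, hw, rfl⟩
    obtain ⟨s, hs, hcard⟩ := hw.two_mul_card_le
    have := hk.2 ⟨s, hs, rfl⟩
    omega
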